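/- arXiv:1202.1584 — 3 statements merged into one kernel-verified Lean document; each statement's English description precedes it below -/
import Mathlib

section
/- (Theorem 1, conditional form.) Let Δ be the maximum vertex degree of G. Let T_opt be a multicast tree spanning M that minimizes Ψ among all multicast trees spanning M, and let T_A be a multicast tree spanning M with lv(T_A) ⊆ M and |in(T_A)| ≤ (4·ln(Δ + 1) + 6)·|in(T_opt)|. Then Ψ(T_A) ≤ (4·ln(Δ + 1) + 7)·Ψ(T_opt). -/
namespace MEGCOM

/-- The set of internal nodes (degree at least 2) of a subgraph `T`. -/
def inn {V : Type*} {G : SimpleGraph V} (T : G.Subgraph) : Set V :=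
  {v | v ∈ T.verts ∧ 2 ≤ (T.neighborSet v).ncard}

/-- The set of degree-one nodes of a subgraph `T`. -/
def lv {V : Type*} {G : SimpleGraph V} (T : G.Subgraph) : Set V :=
  {v | v ∈ T.verts ∧ (T.neighborSet v).ncard = 1}

/-- `T` is a multicast tree spanning the member set `M`. -/
def IsMulticastTree {V : Type*} (G : SimpleGraph V) (M : Finset V) (T : G.Subgraph) : Prop :=
  T.coe.IsTree ∧ ↑M ⊆ T.verts

/-- Total energy `Ψ(T)` of a group communication session using `T` (fixed tx power). -/
noncomputable def psi {V : Type*} [Fintype V] {G : SimpleGraph V} (T : G.Subgraph)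
    (M : Finset V) (p : V → ℕ) (εs εr : ℝ) : ℝ :=
  (∑ u ∈ M, (p u : ℝ)) * ((inn T).ncard : ℝ) * εs
    + (∑ᶠ u ∈ lv T, (p u : ℝ)) * εs
    + (∑ u ∈ M, (p u : ℝ)) * ((T.verts.ncard : ℝ) - 1) * εr

lemma lv_empty_of_one {V : Type*} [Fintype V] {G : SimpleGraph V} (T : G.Subgraph)
    (h : T.verts.ncard = 1) : lv T = ∅ ∧ inn T = ∅ := by
  obtain ⟨a, ha⟩ := Set.ncard_eq_one.mp h
  have key : ∀ v ∈ T.verts, (T.neighborSet v).ncard = 0 := by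
    intro v hv
    rw [Set.ncard_eq_zero (Set.toFinite _)]
    ext w
    simp only [SimpleGraph.Subgraph.mem_neighborSet, Set.mem_empty_iff_false, iff_false]
    intro hw
    have h1 := hw.snd_mem
    have h2 := hw.ne
    rw [ha] at h1 hv
    simp only [Set.mem_singleton_iff] at h1 hv
    exact h2 (hv.trans h1.symm)
  constructor
  · ext v
    simp only [lv, Set.mem_ofPred_eq, Set.mem_empty_iff_false, iff_false, not_and]
    intro hv
    rw [key v hv]; simp
  · ext v
    simp only [inn, Set.mem_ofPred_eq, Set.mem_empty_iff_false, iff_false, not_and]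
    intro hv
    rw [key v hv]; simp

lemma tree_facts {V : Type*} [Fintype V] {G : SimpleGraph V} (T : G.Subgraph)
    (hT : T.coe.IsTree) (h : T.verts.ncard ≠ 1) :
    inn T ∪ lv T = T.verts ∧ (inn T).ncard + (lv T).ncard = T.verts.ncard ∧
      1 ≤ (lv T).ncard ∧ 2 ≤ T.verts.ncard := by
  classical
  have hne : Nonempty T.verts := hT.connected.nonempty
  have hpos : 0 < T.verts.ncard :=
    (Set.ncard_pos (Set.toFinite _)).mpr (Set.nonempty_coe_sort.mp hne)
  have h2 : 2 ≤ T.verts.ncard := by omega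
  have hnt : Nontrivial T.verts := by
    rw [Set.nontrivial_coe_sort]
    exact Set.one_lt_ncard_iff_nontrivial.mp h2
  have hu : inn T ∪ lv T = T.verts := by
    ext v
    simp only [inn, lv, Set.mem_union, Set.mem_ofPred_eq]
    constructor
    · rintro (⟨h, -⟩ | ⟨h, -⟩) <;> exact h
    · intro hv
      obtain ⟨w, hw⟩ := hT.connected.preconnected.exists_adj_of_nontrivial ⟨v, hv⟩
      have : 0 < (T.neighborSet v).ncard :=
        (Set.ncard_pos (Set.toFinite _)).mpr ⟨w, hw⟩
      by_cases h1 : (T.neighborSet v).ncard = 1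
      · exact Or.inr ⟨hv, h1⟩
      · exact Or.inl ⟨hv, by omega⟩
  have hd : Disjoint (inn T) (lv T) := by
    rw [Set.disjoint_left]
    rintro v ⟨_, h1⟩ ⟨_, h2⟩
    omega
  refine ⟨hu, ?_, ?_, h2⟩
  · rw [← Set.ncard_union_eq hd (Set.toFinite _) (Set.toFinite _), hu]
  · obtain ⟨v, hv⟩ := hT.exists_vert_degree_one_of_nontrivial
    rw [SimpleGraph.Subgraph.coe_degree] at hv
    apply (Set.ncard_pos (Set.toFinite _)).mpr
    refine ⟨v, v.2, ?_⟩
    rw [Set.ncard_eq_toFinset_card', SimpleGraph.Subgraph.finset_card_neighborSet_eq_degree]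
    convert hv

lemma leaf_sum_le {V : Type*} [Fintype V] (M : Finset V) (p : V → ℕ) (s : Set V)
    (hs : s ⊆ ↑M) : ∑ᶠ u ∈ s, (p u : ℝ) ≤ ∑ u ∈ M, (p u : ℝ) := by
  classical
  rw [finsum_mem_eq_finite_toFinset_sum _ (Set.toFinite s)]
  apply Finset.sum_le_sum_of_subset_of_nonneg
  · intro x hx
    exact hs (by simpa using hx)
  · intros; positivity

/-- Theorem 1, conditional form. -/
theorem stmt4 {V : Type*} [Fintype V] {G : SimpleGraph V} [DecidableRel G.Adj]
    (M : Finset V) (p : V → ℕ) (hp : ∀ u ∉ M, p u = 0) (εs εr : ℝ)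
    (hεs : 0 < εs) (hεr : 0 < εr) (hrs : εr ≤ εs)
    (Topt TA : G.Subgraph)
    (hTopt : IsMulticastTree G M Topt)
    (hopt : ∀ S : G.Subgraph, IsMulticastTree G M S →
      psi Topt M p εs εr ≤ psi S M p εs εr)
    (hTA : IsMulticastTree G M TA) (hlv : lv TA ⊆ ↑M)
    (hin : ((inn TA).ncard : ℝ) ≤
      (4 * Real.log ((G.maxDegree : ℝ) + 1) + 6) * ((inn Topt).ncard : ℝ)) :
    psi TA M p εs εr ≤
      (4 * Real.log ((G.maxDegree : ℝ) + 1) + 7) * psi Topt M p εs εr := by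
  have ha : 0 ≤ Real.log ((G.maxDegree : ℝ) + 1) := Real.log_nonneg (by simp)
  set a : ℝ := 4 * Real.log ((G.maxDegree : ℝ) + 1) + 6 with hadef
  have ha6 : 0 ≤ a := by linarith
  have haa : 4 * Real.log ((G.maxDegree : ℝ) + 1) + 7 = a + 1 := by rw [hadef]; ring
  rw [haa]
  have hk : (0 : ℝ) ≤ ∑ u ∈ M, (p u : ℝ) := by positivity
  have hPo : (0 : ℝ) ≤ ∑ᶠ u ∈ lv Topt, (p u : ℝ) :=
    finsum_nonneg fun _ => finsum_nonneg fun _ => by positivity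
  have hPA := leaf_sum_le M p (lv TA) hlv
  have hMo : M.card ≤ Topt.verts.ncard := by
    rw [← Set.ncard_coe_finset]
    exact Set.ncard_le_ncard hTopt.2 (Set.toFinite _)
  have hLA : (lv TA).ncard ≤ M.card := by
    rw [← Set.ncard_coe_finset]
    exact Set.ncard_le_ncard hlv (Set.toFinite _)
  have hIo : (inn Topt).ncard + 1 ≤ Topt.verts.ncard := by
    by_cases h1 : Topt.verts.ncard = 1
    · simp [h1, (lv_empty_of_one Topt h1).2]
    · have := tree_facts Topt hTopt.1 h1
      omega
  have hIoR : ((inn Topt).ncard : ℝ) + 1 ≤ (Topt.verts.ncard : ℝ) := by exact_mod_cast hIo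
  have hMoR : (M.card : ℝ) ≤ (Topt.verts.ncard : ℝ) := by exact_mod_cast hMo
  have hLAR : ((lv TA).ncard : ℝ) ≤ (M.card : ℝ) := by exact_mod_cast hLA
  have hI0 : (0 : ℝ) ≤ ((inn Topt).ncard : ℝ) := by positivity
  have hn : (TA.verts.ncard : ℝ) - 1 ≤ (a + 1) * ((Topt.verts.ncard : ℝ) - 1) := by
    by_cases h1 : TA.verts.ncard = 1
    · rw [h1]
      have : 0 ≤ (a + 1) * ((Topt.verts.ncard : ℝ) - 1) :=
        mul_nonneg (by linarith) (by linarith)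
      simpa using this
    · have h2 : ((inn TA).ncard : ℝ) + ((lv TA).ncard : ℝ) = (TA.verts.ncard : ℝ) := by
        exact_mod_cast (tree_facts TA hTA.1 h1).2.1
      have h3 : a * ((inn Topt).ncard : ℝ) ≤ a * ((Topt.verts.ncard : ℝ) - 1) :=
        mul_le_mul_of_nonneg_left (by linarith) ha6
      linarith
  have hP : ∑ᶠ u ∈ lv TA, (p u : ℝ) ≤ (∑ u ∈ M, (p u : ℝ)) * ((inn Topt).ncard : ℝ)
      + ∑ᶠ u ∈ lv Topt, (p u : ℝ) := by
    by_cases h0 : (inn Topt).ncard = 0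
    · rw [h0]
      by_cases h1 : Topt.verts.ncard = 1
      · have h2 : TA.verts.ncard = 1 := by
          by_contra h2
          have h3 := tree_facts TA hTA.1 h2
          have h4 : (inn TA).ncard = 0 := by
            rw [h0] at hin
            have : ((inn TA).ncard : ℝ) ≤ 0 := by simpa using hin
            exact_mod_cast le_antisymm this (by positivity)
          omega
        rw [(lv_empty_of_one TA h2).1]
        simpa using hPo
      · have h3 := (tree_facts Topt hTopt.1 h1).1
        rw [(Set.ncard_eq_zero (Set.toFinite _)).mp h0, Set.empty_union] at h3
        have h4 : ∑ᶠ u ∈ lv Topt, (p u : ℝ) = ∑ u ∈ M, (p u : ℝ) := by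
          apply finsum_mem_eq_sum_of_subset
          · rintro x ⟨_, hx⟩
            by_contra hxM
            exact hx (by simp [hp x hxM])
          · rw [h3]; exact hTopt.2
        rw [h4]
        simpa using hPA
    · have h1 : (1 : ℝ) ≤ ((inn Topt).ncard : ℝ) := by
        exact_mod_cast Nat.one_le_iff_ne_zero.mpr h0
      nlinarith
  unfold psi
  generalize ∑ u ∈ M, (p u : ℝ) = k at *
  generalize ∑ᶠ u ∈ lv TA, (p u : ℝ) = PA at *
  generalize ∑ᶠ u ∈ lv Topt, (p u : ℝ) = Po at *
  have e1 := mul_le_mul_of_nonneg_right (mul_le_mul_of_nonneg_left hin hk) hεs.le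
  have e2 := mul_le_mul_of_nonneg_right hP hεs.le
  have e3 := mul_le_mul_of_nonneg_right (mul_le_mul_of_nonneg_left hn hk) hεr.le
  have e4 : 0 ≤ a * (Po * εs) := by positivity
  linarith

end MEGCOM
end

section
/- Let T be a tree subgraph of G with nonempty vertex set nd(T), and let C be a finite set of vertices of G such that every c ∈ C is at graph distance at most 2 in G from some vertex of nd(T). Then there exists a tree subgraph T'' of G whose vertex set contains C ∪ nd(T) and satisfies |nd(T'')| ≤ |nd(T)| + 2·|C|. In particular, the minimum Steiner tree in G spanning C has at most |nd(T)| + 2·|C| vertices. -/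
namespace MEGCOM

/-- `C` is a guardian set for `M` in `G`: every member of `M` lies in `C` or is
adjacent in `G` to some vertex of `C`. -/
def IsGuardianSet {V : Type*} (G : SimpleGraph V) (M C : Set V) : Prop :=
  ∀ u ∈ M, u ∈ C ∨ ∃ c ∈ C, G.Adj u c

theorem exists_connected_aux {V : Type*} [Fintype V] {G : SimpleGraph V} (T : G.Subgraph)
    (hT : T.Connected) (C : Set V)
    (hC : ∀ c ∈ C, ∃ t ∈ T.verts, ∃ q : G.Walk c t, q.length ≤ 2) :
    ∃ K : G.Subgraph, K.Connected ∧ C ∪ T.verts ⊆ K.verts ∧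
      K.verts.ncard ≤ T.verts.ncard + 2 * C.ncard := by
  classical
  induction C, C.toFinite using Set.Finite.induction_on with
  | empty => exact ⟨T, hT, by simp, by simp⟩
  | @insert c C hc hfin ih =>
    obtain ⟨K, hK, hsub, hcard⟩ := ih (fun x hx => hC x (Set.mem_insert_of_mem _ hx))
    obtain ⟨t, ht, q, hq⟩ := hC c (Set.mem_insert _ _)
    have htK : t ∈ K.verts := hsub (Or.inr ht)
    refine ⟨K ⊔ q.reverse.toSubgraph, ?_, ?_, ?_⟩
    · refine SimpleGraph.Subgraph.connected_sup hK.preconnected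
        (q.reverse.toSubgraph_connected).preconnected
        ⟨t, htK, q.reverse.start_mem_verts_toSubgraph⟩
    · rintro x (hx | hx)
      · rcases hx with rfl | hx
        · exact Or.inr q.reverse.end_mem_verts_toSubgraph
        · exact Or.inl (hsub (Or.inl hx))
      · exact Or.inl (hsub (Or.inr hx))
    · have h1 : (K ⊔ q.reverse.toSubgraph).verts ⊆
          K.verts ∪ (q.reverse.support.tail.toFinset : Set V) := by
        rintro x (hx | hx)
        · exact Or.inl hx
        · rw [SimpleGraph.Walk.mem_verts_toSubgraph, SimpleGraph.Walk.mem_support_iff] at hx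
          rcases hx with rfl | hx
          · exact Or.inl htK
          · exact Or.inr (by simpa using hx)
      have h2 := Set.ncard_le_ncard h1 (Set.toFinite _)
      have h3 := Set.ncard_union_le K.verts (q.reverse.support.tail.toFinset : Set V)
      have h4 : (q.reverse.support.tail.toFinset : Set V).ncard ≤ 2 := by
        rw [Set.ncard_coe_finset]
        refine (List.toFinset_card_le _).trans ?_
        rw [List.length_tail, SimpleGraph.Walk.length_support, SimpleGraph.Walk.length_reverse]
        omega
      rw [Set.ncard_insert_of_notMem hc hfin]
      omega

/-- a Steiner tree spanning `C ∪ nd(T)` with at most `|nd(T)| + 2|C|`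
vertices exists when every point of `C` is within distance 2 of `T`. -/
theorem stmt8 {V : Type*} [Fintype V] {G : SimpleGraph V} (T : G.Subgraph)
    (hT : T.coe.IsTree) (hne : T.verts.Nonempty) (C : Set V)
    (hC : ∀ c ∈ C, ∃ t ∈ T.verts, ∃ q : G.Walk c t, q.length ≤ 2) :
    ∃ T'' : G.Subgraph, T''.coe.IsTree ∧ C ∪ T.verts ⊆ T''.verts ∧
      T''.verts.ncard ≤ T.verts.ncard + 2 * C.ncard := by
  obtain ⟨K, hK, hsub, hcard⟩ := exists_connected_aux T ⟨hT.connected⟩ C hC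
  obtain ⟨S, hS, hSt⟩ := hK.coe.exists_isTree_le
  let T'' : G.Subgraph :=
    { verts := K.verts
      Adj := fun a b => ∃ (ha : a ∈ K.verts) (hb : b ∈ K.verts), S.Adj ⟨a, ha⟩ ⟨b, hb⟩
      adj_sub := by
        rintro a b ⟨ha, hb, h⟩
        exact K.adj_sub (hS h)
      edge_vert := by
        rintro a b ⟨ha, hb, h⟩
        exact ha
      symm := by
        constructor
        rintro a b ⟨ha, hb, h⟩
        exact ⟨hb, ha, h.symm⟩ }
  have heq : T''.coe = S := by
    ext a b
    exact ⟨fun ⟨_, _, h⟩ => h, fun h => ⟨a.2, b.2, h⟩⟩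
  exact ⟨T'', heq ▸ hSt, hsub, hcard⟩

end MEGCOM
end

section
/- (Theorem 3.) Let T, T_W, and T_opt be multicast trees spanning M in an edge-weighted graph, each with at least 3 vertices. Suppose: Θ(T_W) ≤ Θ(S) for every multicast tree S spanning M (in particular Θ(T_W) ≤ Θ(T_opt)); Ψ'(T_opt) ≤ Ψ'(S) for every multicast tree S spanning M; ε_r ≤ λ(v,T) for every v ∈ in(T); |lv(T)| ≤ |M| ≤ |nd(T_opt)|; and Θ(T) ≤ ρ·Θ(T_W) for some real ρ ≥ 0. Then Ψ'(T) ≤ (3ρ + 1)·Ψ'(T_opt). -/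
namespace MEGCOM

/-- `λ(u,T)`: the maximum weight of an edge of `T` incident to `u`. -/
noncomputable def lam {V : Type*} {G : SimpleGraph V} (w : V → V → ℝ)
    (T : G.Subgraph) (u : V) : ℝ :=
  sSup (w u '' T.neighborSet u)

/-- `Θ(T) = ∑_{u ∈ in(T)} λ(u,T)`. -/
noncomputable def theta {V : Type*} {G : SimpleGraph V} (w : V → V → ℝ)
    (T : G.Subgraph) : ℝ :=
  ∑ᶠ u ∈ inn T, lam w T u

/-- Adjustable-power session energy `Ψ'(T)`. -/
noncomputable def psi' {V : Type*} [Fintype V] {G : SimpleGraph V} (w : V → V → ℝ)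
    (T : G.Subgraph) (M : Finset V) (p : V → ℕ) (εr : ℝ) : ℝ :=
  (∑ u ∈ M, (p u : ℝ)) * theta w T
    + (∑ᶠ u ∈ lv T, lam w T u * (p u : ℝ))
    + (∑ u ∈ M, (p u : ℝ)) * ((T.verts.ncard : ℝ) - 1) * εr

theorem verts_subset_of_closed {V : Type*} {G : SimpleGraph V} {T : G.Subgraph}
    (hT : T.coe.IsTree) (s : Set V) (u : V) (hu : u ∈ T.verts) (hus : u ∈ s)
    (hs : ∀ a ∈ s, ∀ b, T.Adj a b → b ∈ s) : T.verts ⊆ s := by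
  intro x hx
  have h : T.coe.Reachable ⟨u, hu⟩ ⟨x, hx⟩ := hT.connected.preconnected _ _
  rw [SimpleGraph.reachable_iff_reflTransGen] at h
  have key : ∀ y : T.verts, Relation.ReflTransGen T.coe.Adj ⟨u, hu⟩ y → (y : V) ∈ s := by
    intro y hy
    induction hy with
    | refl => exact hus
    | tail _ hbc ih => exact hs _ ih _ hbc
  exact key _ h

theorem one_le_degree {V : Type*} [Fintype V] {G : SimpleGraph V} {T : G.Subgraph}
    (hT : T.coe.IsTree) (h3 : 3 ≤ T.verts.ncard) (u : V) (hu : u ∈ T.verts) :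
    1 ≤ (T.neighborSet u).ncard := by
  by_contra hlt
  have h0 : (T.neighborSet u).ncard = 0 := by omega
  rw [Set.ncard_eq_zero (Set.toFinite _)] at h0
  have hsub : T.verts ⊆ {u} := by
    refine verts_subset_of_closed hT _ u hu rfl ?_
    rintro a rfl b hab
    have : b ∈ T.neighborSet a := hab
    rw [h0] at this
    exact this.elim
  have := Set.ncard_le_ncard hsub (Set.toFinite _)
  rw [Set.ncard_singleton] at this
  omega

theorem leaf_neighbor {V : Type*} [Fintype V] {G : SimpleGraph V} {T : G.Subgraph}
    (hT : T.coe.IsTree) (h3 : 3 ≤ T.verts.ncard) (u : V) (hu : u ∈ lv T) :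
    ∃ v ∈ inn T, T.neighborSet u = {v} := by
  obtain ⟨huT, h1⟩ := hu
  obtain ⟨v, hv⟩ := Set.ncard_eq_one.1 h1
  have huv : T.Adj u v := by
    have : v ∈ T.neighborSet u := by rw [hv]; rfl
    exact this
  refine ⟨v, ⟨huv.snd_mem, ?_⟩, hv⟩
  by_contra hlt
  have hle : (T.neighborSet v).ncard ≤ 1 := by omega
  rw [Set.ncard_le_one (Set.toFinite _)] at hle
  have hsub : T.verts ⊆ {u, v} := by
    refine verts_subset_of_closed hT _ u huT (Or.inl rfl) ?_
    rintro a (rfl | rfl) b hab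
    · have : b ∈ T.neighborSet a := hab
      rw [hv] at this
      exact Or.inr this
    · exact Or.inl (hle b hab u huv.symm)
  have := Set.ncard_le_ncard hsub (Set.toFinite _)
  have := Set.ncard_pair huv.ne
  omega

theorem lam_nonneg {V : Type*} {G : SimpleGraph V} (w : V → V → ℝ)
    (hw : ∀ u v, 0 ≤ w u v) (T : G.Subgraph) (u : V) : 0 ≤ lam w T u := by
  apply Real.sSup_nonneg
  rintro _ ⟨v, _, rfl⟩
  exact hw _ _

theorem finsum_mem_nonneg' {V : Type*} (s : Set V) (f : V → ℝ) (hf : ∀ u, 0 ≤ f u) :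
    0 ≤ ∑ᶠ u ∈ s, f u :=
  finsum_nonneg fun u => finsum_nonneg fun _ => hf u

theorem lam_le_theta {V : Type*} [Fintype V] {G : SimpleGraph V} (w : V → V → ℝ)
    (hw : ∀ u v, 0 ≤ w u v) (T : G.Subgraph) (v : V) (hv : v ∈ inn T) :
    lam w T v ≤ theta w T := by
  classical
  unfold theta
  rw [finsum_mem_eq_finite_toFinset_sum _ (Set.toFinite (inn T))]
  exact Finset.single_le_sum (f := lam w T) (fun u _ => lam_nonneg w hw T u)
    ((Set.Finite.mem_toFinset _).2 hv)

theorem leaf_lam_le {V : Type*} [Fintype V] {G : SimpleGraph V} (w : V → V → ℝ)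
    (hs : ∀ u v, w u v = w v u)
    (hw : ∀ u v, 0 ≤ w u v) (T : G.Subgraph)
    (hT : T.coe.IsTree) (h3 : 3 ≤ T.verts.ncard) (u : V) (hu : u ∈ lv T) :
    lam w T u ≤ theta w T := by
  obtain ⟨v, hv, hn⟩ := leaf_neighbor hT h3 u hu
  refine le_trans ?_ (lam_le_theta w hw T v hv)
  have huv : T.Adj u v := by
    have : v ∈ T.neighborSet u := by rw [hn]; rfl
    exact this
  have : lam w T u = w v u := by
    unfold lam
    rw [hn, Set.image_singleton, csSup_singleton, hs]
  rw [this]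
  exact le_csSup (Set.toFinite _).bddAbove ⟨u, huv.symm, rfl⟩

/-- Theorem 3. -/
theorem stmt14 {V : Type*} [Fintype V] {G : SimpleGraph V} (w : V → V → ℝ)
    (hw_symm : ∀ u v, w u v = w v u) (hw_nonneg : ∀ u v, 0 ≤ w u v)
    (M : Finset V) (p : V → ℕ) (hp : ∀ u ∉ M, p u = 0)
    (T TW Topt : G.Subgraph)
    (hT : IsMulticastTree G M T) (hTW : IsMulticastTree G M TW)
    (hTopt : IsMulticastTree G M Topt)
    (h3T : 3 ≤ T.verts.ncard) (h3W : 3 ≤ TW.verts.ncard)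
    (h3opt : 3 ≤ Topt.verts.ncard)
    (εr : ℝ) (hεr : 0 < εr)
    (hWmin : ∀ S : G.Subgraph, IsMulticastTree G M S → theta w TW ≤ theta w S)
    (hoptmin : ∀ S : G.Subgraph, IsMulticastTree G M S →
      psi' w Topt M p εr ≤ psi' w S M p εr)
    (hlam : ∀ v ∈ inn T, εr ≤ lam w T v)
    (hlv : (lv T).ncard ≤ M.card) (hM : M.card ≤ Topt.verts.ncard)
    (ρ : ℝ) (hρ : 0 ≤ ρ) (hΘ : theta w T ≤ ρ * theta w TW) :
    psi' w T M p εr ≤ (3 * ρ + 1) * psi' w Topt M p εr := by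
  classical
  set k : ℝ := ∑ u ∈ M, (p u : ℝ) with hk
  have hk0 : 0 ≤ k := Finset.sum_nonneg fun u _ => Nat.cast_nonneg _
  have hleaf : (∑ᶠ u ∈ lv T, lam w T u * (p u : ℝ)) ≤ k * theta w T := by
    have hth : 0 ≤ theta w T := finsum_mem_nonneg' _ _ (lam_nonneg w hw_nonneg T)
    rw [finsum_mem_eq_finite_toFinset_sum _ (Set.toFinite (lv T))]
    calc _ ≤ ∑ u ∈ (Set.toFinite (lv T)).toFinset, theta w T * (p u : ℝ) := by
          refine Finset.sum_le_sum fun u hu => ?_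
          exact mul_le_mul_of_nonneg_right (leaf_lam_le w hw_symm hw_nonneg T hT.1 h3T u
            ((Set.Finite.mem_toFinset _).1 hu)) (Nat.cast_nonneg _)
      _ ≤ ∑ u, theta w T * (p u : ℝ) :=
          Finset.sum_le_sum_of_subset_of_nonneg (Finset.subset_univ _)
            fun u _ _ => mul_nonneg hth (Nat.cast_nonneg _)
      _ = ∑ u ∈ M, theta w T * (p u : ℝ) := by
          symm
          refine Finset.sum_subset (Finset.subset_univ _) fun u _ hu => ?_
          simp [hp u hu]
      _ = k * theta w T := by rw [← Finset.mul_sum, mul_comm]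
  have hin : ((inn T).ncard : ℝ) * εr ≤ theta w T := by
    unfold theta
    rw [finsum_mem_eq_finite_toFinset_sum _ (Set.toFinite (inn T)),
      Set.ncard_eq_toFinset_card _ (Set.toFinite (inn T)), ← nsmul_eq_mul]
    exact Finset.card_nsmul_le_sum _ _ _ fun u hu =>
      hlam u ((Set.Finite.mem_toFinset _).1 hu)
  have hcard : T.verts.ncard ≤ (inn T).ncard + (lv T).ncard := by
    refine le_trans (Set.ncard_le_ncard ?_ (Set.toFinite _)) (Set.ncard_union_le _ _)
    intro u hu
    have := one_le_degree hT.1 h3T u hu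
    by_cases h : (T.neighborSet u).ncard = 1
    · exact Or.inr ⟨hu, h⟩
    · exact Or.inl ⟨hu, by omega⟩
  have hcard' : (T.verts.ncard : ℝ) ≤ (inn T).ncard + Topt.verts.ncard := by
    exact_mod_cast (by omega : T.verts.ncard ≤ (inn T).ncard + Topt.verts.ncard)
  have hrec : ((T.verts.ncard : ℝ) - 1) * εr
      ≤ theta w T + ((Topt.verts.ncard : ℝ) - 1) * εr := by
    nlinarith [mul_le_mul_of_nonneg_right hcard' hεr.le]
  have hrec' := mul_le_mul_of_nonneg_left hrec hk0
  have hΘ' : theta w T ≤ ρ * theta w Topt :=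
    hΘ.trans (mul_le_mul_of_nonneg_left (hWmin _ hTopt) hρ)
  have hΘk := mul_le_mul_of_nonneg_left hΘ' hk0
  have hthopt : 0 ≤ k * theta w Topt :=
    mul_nonneg hk0 (finsum_mem_nonneg' _ _ (lam_nonneg w hw_nonneg Topt))
  have hlopt : 0 ≤ ∑ᶠ u ∈ lv Topt, lam w Topt u * (p u : ℝ) :=
    finsum_mem_nonneg' _ _ fun u => mul_nonneg (lam_nonneg w hw_nonneg Topt u) (Nat.cast_nonneg _)
  have h3 : (3 : ℝ) ≤ Topt.verts.ncard := by exact_mod_cast h3opt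
  have hropt : 0 ≤ k * ((Topt.verts.ncard : ℝ) - 1) * εr :=
    mul_nonneg (mul_nonneg hk0 (by linarith)) hεr.le
  unfold psi'
  rw [← hk]
  have e1 := mul_nonneg hρ hlopt
  have e2 := mul_nonneg hρ hropt
  linarith

end MEGCOM
end
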